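/- Let 1<p₁,p₂<∞ and 0<α<2n. Let b be a real-valued BMO function with ‖b‖_{BMO} = 1, let Q_j be a cube with center y_j satisfying ⨍_{Q_j}|b − b_{Q_j}| ≥ ε for some ε>0, and let f_j and g_j be the associated test functions. Then for all x outside the cube 2√n·Q_j (the cube concentric with Q_j with side length 2√n times that of Q_j), |I_α((b−b_{Q_j})f_j, g_j)(x)| ≥ c ε |Q_j|^{1/p₁' + 1/p₂'} |x−y_j|^{−2n+α}, where c>0 is independent of b, ε, Q_j, and x. -/

import Mathlib

open MeasureTheory Set Filter
open scoped ENNReal BigOperators Topology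

noncomputable section

/-- Euclidean space `ℝⁿ`. -/
abbrev Rn (n : ℕ) : Type := EuclideanSpace ℝ (Fin n)

/-- The closed axis-parallel cube with center `c` and side length `d`. -/
def cube (n : ℕ) (c : Rn n) (d : ℝ) : Set (Rn n) :=
  {x | ∀ i : Fin n, |x i - c i| ≤ d / 2}

/-- The average `b_Q` of `b` over the cube with center `c` and side length `d`. -/
def cubeAvg (n : ℕ) (b : Rn n → ℝ) (c : Rn n) (d : ℝ) : ℝ :=
  ⨍ x in cube n c d, b x

/-- The mean oscillation `⨍_Q |b - b_Q|` of `b` over a cube. -/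
def osc (n : ℕ) (b : Rn n → ℝ) (c : Rn n) (d : ℝ) : ℝ :=
  ⨍ x in cube n c d, |b x - cubeAvg n b c d|

/-- The BMO seminorm: supremum of mean oscillations over all axis-parallel cubes. -/
def bmoNorm (n : ℕ) (b : Rn n → ℝ) : ℝ :=
  ⨆ cd : Rn n × {d : ℝ // 0 < d}, osc n b cd.1 cd.2.1

/-- `b ∈ CMO`: `b` belongs to the closure of `C_c^∞` in the BMO seminorm. -/
def MemCMO (n : ℕ) (b : Rn n → ℝ) : Prop :=
  ∀ ε : ℝ, 0 < ε → ∃ φ : Rn n → ℝ, ContDiff ℝ (⊤ : ℕ∞) φ ∧ HasCompactSupport φ ∧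
    bmoNorm n (b - φ) < ε

/-- The conjugate exponent `p' = p/(p-1)`. -/
def conjExp (p : ℝ) : ℝ := p / (p - 1)

/-- The Muckenhoupt class `A_p`. -/
def MuckenhouptAp (n : ℕ) (p : ℝ) (w : Rn n → ℝ) : Prop :=
  (∀ x, 0 ≤ w x) ∧ LocallyIntegrable w volume ∧
  ∃ C : ℝ, ∀ (c : Rn n) (d : ℝ), 0 < d →
    (⨍ x in cube n c d, w x) *
      (⨍ x in cube n c d, w x ^ (1 - conjExp p)) ^ (p / conjExp p) ≤ C

/-- The `A_p` characteristic constant `[w]_{A_p}`. -/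
def apConst (n : ℕ) (p : ℝ) (w : Rn n → ℝ) : ℝ :=
  ⨆ cd : Rn n × {d : ℝ // 0 < d},
    (⨍ x in cube n cd.1 cd.2.1, w x) *
      (⨍ x in cube n cd.1 cd.2.1, w x ^ (1 - conjExp p)) ^ (p / conjExp p)

/-- The bilinear class `A_{P,q}` for `P = (p₁,p₂)`. -/
def MuckenhouptAPq (n : ℕ) (p₁ p₂ q : ℝ) (w₁ w₂ : Rn n → ℝ) : Prop :=
  ∃ C : ℝ, ∀ (c : Rn n) (d : ℝ), 0 < d →
    (⨍ x in cube n c d, (w₁ x * w₂ x) ^ q) *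
      (⨍ x in cube n c d, w₁ x ^ (-(conjExp p₁))) ^ (q / conjExp p₁) *
      (⨍ x in cube n c d, w₂ x ^ (-(conjExp p₂))) ^ (q / conjExp p₂) ≤ C

/-- The kernel of the bilinear fractional integral `I_α`. -/
def fracKernel (n : ℕ) (α : ℝ) (x y z : Rn n) : ℝ :=
  (‖x - y‖ ^ 2 + ‖x - z‖ ^ 2) ^ (-((n : ℝ) - α / 2))

/-- The bilinear fractional integral operator `I_α`. -/
def Iop (n : ℕ) (α : ℝ) (f g : Rn n → ℝ) (x : Rn n) : ℝ :=
  ∫ y, ∫ z, fracKernel n α x y z * (f y * g z)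

/-- The first commutator `[b, I_α]₁(f,g) = I_α(bf, g) - b · I_α(f,g)`. -/
def commI (n : ℕ) (α : ℝ) (b f g : Rn n → ℝ) : Rn n → ℝ :=
  fun x => Iop n α (fun y => b y * f y) g x - b x * Iop n α f g x

/-- The weighted Lᵖ norm `(∫ |f|^p w)^{1/p}` (with value in `ℝ≥0∞`). -/
def wNorm (n : ℕ) (p : ℝ) (w : Rn n → ℝ) (f : Rn n → ℝ) : ℝ≥0∞ :=
  (∫⁻ x, ENNReal.ofReal (|f x| ^ p * w x)) ^ (1 / p)

/-- A bilinear operator `T` is compact from `L^{p₁}(w₁) × L^{p₂}(w₂)` to `L^q(μ)` when the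
image of the product of unit balls is precompact in `L^q(μ)`; equivalently (by completeness),
every sequence in the image of the unit balls admits a subsequence which is Cauchy for the
`L^q(μ)` norm. -/
def BilinCompact (n : ℕ) (p₁ p₂ q : ℝ) (w₁ w₂ μ : Rn n → ℝ)
    (T : (Rn n → ℝ) → (Rn n → ℝ) → Rn n → ℝ) : Prop :=
  ∀ F G : ℕ → Rn n → ℝ,
    (∀ j, wNorm n p₁ w₁ (F j) ≤ 1) → (∀ j, wNorm n p₂ w₂ (G j) ≤ 1) →
    ∃ φ : ℕ → ℕ, StrictMono φ ∧
      ∀ ε : ℝ, 0 < ε → ∃ N : ℕ, ∀ j ≥ N, ∀ k ≥ N,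
        wNorm n q μ (fun x => T (F (φ j)) (G (φ j)) x - T (F (φ k)) (G (φ k)) x)
          < ENNReal.ofReal ε

/-- The smoothly truncated kernel `K^δ` with implicit constant `A`. -/
def IsTruncKernel (n : ℕ) (α δ A : ℝ) (K : Rn n → Rn n → Rn n → ℝ) : Prop :=
  ContDiff ℝ 1 (fun pt : Rn n × Rn n × Rn n => K pt.1 pt.2.1 pt.2.2) ∧
  (∀ x y z, 2 * δ < max ‖x - y‖ ‖x - z‖ → K x y z = fracKernel n α x y z) ∧
  (∀ x y z, max ‖x - y‖ ‖x - z‖ < δ → K x y z = 0) ∧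
  (∀ x y z : Rn n, |K x y z| ≤ A * (‖x - y‖ + ‖x - z‖) ^ (-(2 * (n : ℝ) - α))) ∧
  (∀ x y z : Rn n,
    ‖fderiv ℝ (fun pt : Rn n × Rn n × Rn n => K pt.1 pt.2.1 pt.2.2) (x, y, z)‖ ≤
      A * (‖x - y‖ + ‖x - z‖) ^ (-(2 * (n : ℝ) - α - 1)))

/-- The bilinear operator with kernel `K`. -/
def IopK (n : ℕ) (K : Rn n → Rn n → Rn n → ℝ) (f g : Rn n → ℝ) (x : Rn n) : ℝ :=
  ∫ y, ∫ z, K x y z * (f y * g z)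

/-- The first commutator of the truncated operator. -/
def commIK (n : ℕ) (K : Rn n → Rn n → Rn n → ℝ) (b f g : Rn n → ℝ) : Rn n → ℝ :=
  fun x => IopK n K (fun y => b y * f y) g x - b x * IopK n K f g x

/-- The bilinear fractional maximal function `M_α`. -/
def Mmax (n : ℕ) (α : ℝ) (f g : Rn n → ℝ) (x : Rn n) : ℝ :=
  ⨆ cd : {cd : Rn n × ℝ // 0 < cd.2 ∧ x ∈ cube n cd.1 cd.2},
    ((cd : Rn n × ℝ).2 ^ n) ^ (α / n) *
      ((⨍ y in cube n (cd : Rn n × ℝ).1 (cd : Rn n × ℝ).2, |f y|) *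
        (⨍ z in cube n (cd : Rn n × ℝ).1 (cd : Rn n × ℝ).2, |g z|))

/-- The test function `f_j` associated to the cube with center `c`, side `d` and symbol `b`:
`f_j = |Q|^{-1/p₁} (sgn(b - b_Q) - c₀) χ_Q` where `c₀ = ⨍_Q sgn(b - b_Q)`. -/
def testF (n : ℕ) (p₁ : ℝ) (b : Rn n → ℝ) (c : Rn n) (d : ℝ) : Rn n → ℝ :=
  indicator (cube n c d) fun y =>
    (d ^ n) ^ (-(1 / p₁)) *
      (Real.sign (b y - cubeAvg n b c d) -
        ⨍ z in cube n c d, Real.sign (b z - cubeAvg n b c d))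

/-- The test function `g_j = |Q|^{-1/p₂} χ_Q` associated to the cube with center `c`, side `d`. -/
def testG (n : ℕ) (p₂ : ℝ) (c : Rn n) (d : ℝ) : Rn n → ℝ :=
  indicator (cube n c d) fun _ => (d ^ n) ^ (-(1 / p₂))

end

lemma cube_eq_preimage (n : ℕ) (c : Rn n) (d : ℝ) :
    cube n c d = (@WithLp.ofLp 2 (Fin n → ℝ)) ⁻¹'
      (Set.univ.pi fun i => Icc (c i - d / 2) (c i + d / 2)) := by
  ext x
  simp only [cube, mem_setOf_eq, mem_preimage, mem_univ_pi, mem_Icc, abs_le]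
  refine forall_congr' fun i => ?_
  constructor
  · rintro ⟨h1, h2⟩; constructor <;> linarith
  · rintro ⟨h1, h2⟩; constructor <;> linarith

lemma cube_meas (n : ℕ) (c : Rn n) (d : ℝ) : MeasurableSet (cube n c d) := by
  rw [cube_eq_preimage]
  exact (PiLp.volume_preserving_ofLp (Fin n)).measurable
    (MeasurableSet.univ_pi fun i => measurableSet_Icc)

lemma cube_vol (n : ℕ) (c : Rn n) (d : ℝ) :
    volume (cube n c d) = ENNReal.ofReal d ^ n := by
  rw [cube_eq_preimage, (PiLp.volume_preserving_ofLp (Fin n)).measure_preimage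
    (MeasurableSet.univ_pi fun i => measurableSet_Icc).nullMeasurableSet, volume_pi_pi]
  simp only [Real.volume_Icc]
  have : ∀ i, c i + d / 2 - (c i - d / 2) = d := fun i => by ring
  simp [this]

lemma cube_real (n : ℕ) (c : Rn n) (d : ℝ) (hd : 0 < d) :
    volume.real (cube n c d) = d ^ n := by
  simp [Measure.real, cube_vol, hd.le]

lemma cube_near (n : ℕ) (c : Rn n) (d : ℝ) (hd : 0 < d) (y : Rn n) (hy : y ∈ cube n c d) :
    ‖y - c‖ ≤ Real.sqrt n * d / 2 := by
  rw [EuclideanSpace.norm_eq]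
  have : Real.sqrt n * d / 2 = Real.sqrt (n * (d / 2) ^ 2) := by
    rw [Real.sqrt_mul (by positivity), Real.sqrt_sq (by positivity)]; ring
  rw [this]
  apply Real.sqrt_le_sqrt
  calc ∑ i, ‖(y - c) i‖ ^ 2 ≤ ∑ i : Fin n, (d / 2) ^ 2 := by
        refine Finset.sum_le_sum fun i _ => ?_
        have := hy i
        rw [Real.norm_eq_abs]
        exact pow_le_pow_left₀ (abs_nonneg _) this 2
    _ = n * (d / 2) ^ 2 := by simp

lemma cube_far (n : ℕ) (c : Rn n) (d : ℝ) (x : Rn n)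
    (hx : x ∉ cube n c (2 * Real.sqrt n * d)) : Real.sqrt n * d < ‖x - c‖ := by
  simp only [cube, mem_setOf_eq, not_forall, not_le] at hx
  obtain ⟨i, hi⟩ := hx
  have := PiLp.norm_apply_le (x - c) i
  rw [Real.norm_eq_abs] at this
  have h2 : (x - c) i = x i - c i := rfl
  rw [h2] at this
  linarith

lemma cube_bdd (n : ℕ) (c : Rn n) (d : ℝ) (hd : 0 < d) :
    cube n c d ⊆ Metric.closedBall c (Real.sqrt n * d / 2) := fun y hy => by
  rw [Metric.mem_closedBall, dist_eq_norm]
  exact cube_near n c d hd y hy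

lemma abs_sign_le (r : ℝ) : |Real.sign r| ≤ 1 := by
  rcases Real.sign_apply_eq r with h | h | h <;> simp [h]

lemma mul_sign_abs (r : ℝ) : r * Real.sign r = |r| := by
  rcases lt_trichotomy r 0 with h | h | h
  · rw [Real.sign_of_neg h, abs_of_neg h]; ring
  · simp [h]
  · rw [Real.sign_of_pos h, abs_of_pos h]; ring

lemma kernel_bounds (n : ℕ) (α : ℝ) (hα : α < 2 * n) (x c y z : Rn n) (R : ℝ)
    (hR : R = ‖x - c‖) (h0 : 0 < R)
    (hy : ‖y - c‖ ≤ R / 2) (hz : ‖z - c‖ ≤ R / 2) :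
    (9 / 2 : ℝ) ^ (-((n : ℝ) - α / 2)) * R ^ (-(2 * (n : ℝ)) + α) ≤ fracKernel n α x y z ∧
    fracKernel n α x y z ≤ (1 / 2 * R ^ 2) ^ (-((n : ℝ) - α / 2)) := by
  have key : ∀ w : Rn n, ‖w - c‖ ≤ R / 2 → R / 2 ≤ ‖x - w‖ ∧ ‖x - w‖ ≤ 3 / 2 * R := by
    intro w hw
    have e1 : x - w = (x - c) - (w - c) := by abel
    have h1 := norm_sub_le (x - c) (w - c)
    have h2 := norm_sub_norm_le (x - c) (w - c)
    rw [← e1, ← hR] at h1 h2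
    constructor <;> linarith
  obtain ⟨a1, a2⟩ := key y hy
  obtain ⟨b1, b2⟩ := key z hz
  have e : -((n : ℝ) - α / 2) ≤ 0 := by linarith
  have hlow : 1 / 2 * R ^ 2 ≤ ‖x - y‖ ^ 2 + ‖x - z‖ ^ 2 := by nlinarith
  have hup : ‖x - y‖ ^ 2 + ‖x - z‖ ^ 2 ≤ 9 / 2 * R ^ 2 := by nlinarith
  have hp : 0 < 1 / 2 * R ^ 2 := by positivity
  constructor
  · have : R ^ (-(2 * (n : ℝ)) + α) = (R ^ 2) ^ (-((n : ℝ) - α / 2)) := by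
      rw [← Real.rpow_natCast, ← Real.rpow_mul h0.le]
      congr 1; push_cast; ring
    rw [this, ← Real.mul_rpow (by norm_num) (by positivity)]
    exact Real.rpow_le_rpow_of_nonpos (hp.trans_le hlow) hup e
  · exact Real.rpow_le_rpow_of_nonpos hp hlow e


/-- (Pointwise lower bound, Estimate (8).) There is `c > 0`, independent of
`b`, `ε`, the cube and `x`, such that for any real-valued `b` with `‖b‖_{BMO} = 1`, any cube
`Q_j` (center `y_j`, side `d_j`) with `⨍_{Q_j}|b-b_{Q_j}| ≥ ε`, and any `x ∉ 2√n Q_j`,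
`|I_α((b-b_{Q_j})f_j, g_j)(x)| ≥ c ε |Q_j|^{1/p₁'+1/p₂'} |x-y_j|^{-2n+α}`. -/
theorem statement12 (n : ℕ) (hn : 0 < n) (p₁ p₂ α : ℝ)
    (hp₁ : 1 < p₁) (hp₂ : 1 < p₂)
    (hα₀ : 0 < α) (hα₂ : α < 2 * n) :
    ∃ c : ℝ, 0 < c ∧ ∀ b : Rn n → ℝ, LocallyIntegrable b volume → bmoNorm n b = 1 →
      ∀ ε : ℝ, 0 < ε →
        ∀ (yj : Rn n) (dj : ℝ), 0 < dj → ε ≤ osc n b yj dj →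
          ∀ x : Rn n, x ∉ cube n yj (2 * Real.sqrt n * dj) →
            c * ε * (dj ^ n) ^ (1 / conjExp p₁ + 1 / conjExp p₂) *
                ‖x - yj‖ ^ (-(2 * (n : ℝ)) + α) ≤
              |Iop n α (fun y => (b y - cubeAvg n b yj dj) * testF n p₁ b yj dj y)
                (testG n p₂ yj dj) x| := by
  refine ⟨(9 / 2 : ℝ) ^ (-((n : ℝ) - α / 2)), by positivity, ?_⟩
  intro b hb _ ε hε yj d hd hosc x hx
  set Q := cube n yj d with hQ
  have hQm : MeasurableSet Q := cube_meas n yj d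
  have hQr : volume.real Q = d ^ n := cube_real n yj d hd
  have hdn : 0 < d ^ n := by positivity
  have hQf : volume Q ≠ ∞ := by rw [hQ, cube_vol]; exact ENNReal.pow_ne_top ENNReal.ofReal_ne_top
  set m := cubeAvg n b yj d with hm
  set R := ‖x - yj‖ with hR
  have hfar : Real.sqrt n * d < R := cube_far n yj d x hx
  have hsn : 0 < Real.sqrt n := Real.sqrt_pos.2 (by exact_mod_cast hn)
  have hR0 : 0 < R := lt_trans (by positivity) hfar
  have hnear : ∀ y ∈ Q, ‖y - yj‖ ≤ R / 2 := fun y hy => by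
    have := cube_near n yj d hd y hy
    linarith
  set k0 := (9 / 2 : ℝ) ^ (-((n : ℝ) - α / 2)) * R ^ (-(2 * (n : ℝ)) + α) with hk0
  set k1 := (1 / 2 * R ^ 2) ^ (-((n : ℝ) - α / 2)) with hk1
  have hk0p : 0 < k0 := by positivity
  have hK : ∀ y ∈ Q, ∀ z ∈ Q, k0 ≤ fracKernel n α x y z ∧ fracKernel n α x y z ≤ k1 :=
    fun y hy z hz => kernel_bounds n α hα₂ x yj y z R hR hR0 (hnear y hy) (hnear z hz)
  set A := (d ^ n) ^ (-(1 / p₁)) with hA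
  set B := (d ^ n) ^ (-(1 / p₂)) with hB
  have hAp : 0 < A := by positivity
  have hBp : 0 < B := by positivity
  have hbQ : IntegrableOn b Q :=
    (hb.integrableOn_isCompact (isCompact_closedBall yj (Real.sqrt n * d / 2))).mono_set
      (cube_bdd n yj d hd)
  have hbmQ : IntegrableOn (fun y => b y - m) Q :=
    hbQ.sub (integrableOn_const hQf)
  set c0 := ⨍ z in Q, Real.sign (b z - m) with hc0
  have hc0le : |c0| ≤ 1 := by
    rw [hc0, setAverage_eq, hQr, smul_eq_mul, abs_mul, abs_of_pos (inv_pos.2 hdn)]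
    have := norm_setIntegral_le_of_norm_le_const (f := fun z => Real.sign (b z - m)) (C := 1)
      (lt_top_iff_ne_top.2 hQf) (fun z _ => abs_sign_le _)
    rw [hQr, Real.norm_eq_abs, one_mul] at this
    rw [inv_mul_le_iff₀ hdn]; linarith
  have hmean : ∫ y in Q, (b y - m) = 0 := by
    rw [integral_sub hbQ (integrableOn_const hQf), setIntegral_const, hQr, hm, cubeAvg,
      setAverage_eq, ← hQ, hQr, smul_eq_mul, smul_eq_mul]
    field_simp
    ring
  have hoscI : ∫ y in Q, |b y - m| = d ^ n * osc n b yj d := by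
    rw [osc, setAverage_eq, ← hQ, ← hm, hQr, smul_eq_mul]
    field_simp
  set H : Rn n → ℝ := fun y => (b y - m) * testF n p₁ b yj d y with hH
  have hHeq : H = Q.indicator (fun y => A * (|b y - m| - c0 * (b y - m))) := by
    funext y
    by_cases hy : y ∈ Q
    · simp only [hH, testF, ← hQ, ← hm, ← hA, ← hc0, indicator_of_mem hy]
      rw [← mul_sign_abs (b y - m)]; ring
    · simp only [hH, testF, ← hQ, indicator_of_notMem hy, mul_zero]
  have hHint0 : IntegrableOn (fun y => A * (|b y - m| - c0 * (b y - m))) Q :=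
    (hbmQ.abs.sub (hbmQ.const_mul c0)).const_mul A
  have hHint : Integrable H := by
    rw [hHeq]; exact hHint0.integrable_indicator hQm
  have hHI : ∫ y, H y = A * (d ^ n * osc n b yj d) := by
    rw [hHeq, integral_indicator hQm, integral_const_mul, integral_sub hbmQ.abs
      (hbmQ.const_mul c0), integral_const_mul, hmean, hoscI]
    ring
  have hHnn : ∀ y, 0 ≤ H y := by
    intro y
    rw [hHeq]
    refine indicator_nonneg (fun y _ => mul_nonneg hAp.le ?_) y
    have : c0 * (b y - m) ≤ |c0| * |b y - m| := by
      rw [← abs_mul]; exact le_abs_self _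
    nlinarith [abs_nonneg (b y - m)]
  have hHout : ∀ y, y ∉ Q → H y = 0 := fun y hy => by
    rw [hHeq, indicator_of_notMem hy]
  set Φ : Rn n → ℝ := fun y => ∫ z in Q, fracKernel n α x y z * B with hΦ
  have hKm : Measurable (fun p : Rn n × Rn n => fracKernel n α x p.1 p.2 * B) := by
    unfold fracKernel
    fun_prop
  have hΦm : StronglyMeasurable Φ :=
    StronglyMeasurable.integral_prod_right' (ν := volume.restrict Q) hKm.stronglyMeasurable
  have hKi : ∀ y ∈ Q, IntegrableOn (fun z => fracKernel n α x y z * B) Q := by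
    intro y hy
    refine Measure.integrableOn_of_bounded (M := k1 * B) hQf
      (hKm.comp (measurable_const.prodMk measurable_id)).aestronglyMeasurable ?_
    filter_upwards [ae_restrict_mem hQm] with z hz
    have := hK y hy z hz
    rw [Real.norm_eq_abs, abs_of_nonneg (mul_nonneg (hk0p.le.trans this.1) hBp.le)]
    exact mul_le_mul_of_nonneg_right this.2 hBp.le
  have hΦlow : ∀ y ∈ Q, d ^ n * (k0 * B) ≤ Φ y := by
    intro y hy
    have := setIntegral_mono_on (integrableOn_const hQf (C := k0 * B)) (hKi y hy) hQm
      (fun z hz => mul_le_mul_of_nonneg_right (hK y hy z hz).1 hBp.le)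
    rwa [setIntegral_const, hQr, smul_eq_mul] at this
  have hΦup : ∀ y ∈ Q, Φ y ≤ d ^ n * (k1 * B) := by
    intro y hy
    have := setIntegral_mono_on (hKi y hy) (integrableOn_const hQf (C := k1 * B)) hQm
      (fun z hz => mul_le_mul_of_nonneg_right (hK y hy z hz).2 hBp.le)
    rwa [setIntegral_const, hQr, smul_eq_mul] at this
  have hIop : Iop n α H (testG n p₂ yj d) x = ∫ y, H y * Q.indicator Φ y := by
    unfold Iop
    refine integral_congr_ae (Eventually.of_forall fun y => ?_)
    by_cases hy : y ∈ Q
    · simp only [indicator_of_mem hy, hΦ]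
      rw [← integral_const_mul, ← integral_indicator hQm]
      refine integral_congr_ae (Eventually.of_forall fun z => ?_)
      by_cases hz : z ∈ Q
      · simp only [testG, ← hQ, indicator_of_mem hz, ← hB]; ring
      · simp only [testG, ← hQ, indicator_of_notMem hz, mul_zero]
    · simp [hHout y hy]
  have hfin : ∫ y, H y * (d ^ n * (k0 * B)) ≤ ∫ y, H y * Q.indicator Φ y := by
    refine integral_mono (hHint.mul_const _) ?_ ?_
    · refine hHint.mul_bdd (c := d ^ n * (k1 * B)) (hΦm.indicator hQm).aestronglyMeasurable
        (Eventually.of_forall fun y => ?_)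
      by_cases hy : y ∈ Q
      · rw [indicator_of_mem hy, Real.norm_eq_abs, abs_of_nonneg]
        · exact hΦup y hy
        · exact le_trans (by positivity) (hΦlow y hy)
      · rw [indicator_of_notMem hy, norm_zero]; positivity
    · intro y
      by_cases hy : y ∈ Q
      · simp only [indicator_of_mem hy]
        exact mul_le_mul_of_nonneg_left (hΦlow y hy) (hHnn y)
      · simp [hHout y hy]
  rw [hIop]
  refine le_trans ?_ (hfin.trans (le_abs_self _))
  rw [integral_mul_const, hHI]
  have hexp : (d ^ n) ^ (1 / conjExp p₁ + 1 / conjExp p₂) = A * d ^ n * (B * d ^ n) := by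
    have e : ∀ p : ℝ, 1 < p → (d ^ n) ^ (1 / conjExp p) = (d ^ n) ^ (-(1 / p)) * d ^ n := by
      intro p hp
      have h1 : 1 / conjExp p = -(1 / p) + 1 := by
        have : p - 1 ≠ 0 := by linarith
        have : p ≠ 0 := by linarith
        unfold conjExp
        field_simp
        ring
      rw [h1, Real.rpow_add hdn, Real.rpow_one]
    rw [Real.rpow_add hdn, e p₁ hp₁, e p₂ hp₂]
  rw [hexp]
  have : 0 ≤ k0 * (A * d ^ n * (B * d ^ n)) := by positivity
  calc _ = k0 * (A * d ^ n * (B * d ^ n)) * ε := by rw [hk0]; ring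
    _ ≤ k0 * (A * d ^ n * (B * d ^ n)) * osc n b yj d := mul_le_mul_of_nonneg_left hosc this
    _ = _ := by ring
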